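/- For λ ∈ ℂ∖(ℝ₊ ∪ {-1}), the function m₀(λ) = λ/(1+λ√(-λ)) admits the representation m₀(λ) = -2/(3(1+λ)) + ∫₀^∞ (1/(s-λ))·(s^{5/2}/(π(1+s³))) ds. -/

import Mathlib

open MeasureTheory Real Set

/-- Branch of `√(-z)` holomorphic on `ℂ ∖ [0,∞)`, positive on `(-∞,0)`. -/
noncomputable def sqrtNeg (z : ℂ) : ℂ := Complex.exp (Complex.log (-z) / 2)

/-- Quadratic factors `t² + b²` with `0 < Re b` stay away from zero. -/
lemma sq_re_le_norm_sq_add_sq {b : ℂ} (hb : 0 < b.re) (t : ℝ) :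
    b.re ^ 2 ≤ ‖(t : ℂ) ^ 2 + b ^ 2‖ := by
  have h : (t : ℂ) ^ 2 + b ^ 2 = (t - Complex.I * b) * (t + Complex.I * b) := by
    linear_combination b ^ 2 * Complex.I_sq
  have h1 : b.re ≤ ‖(t : ℂ) - Complex.I * b‖ := by
    refine le_trans ?_ (Complex.abs_im_le_norm _)
    simp [abs_of_pos hb]
  have h2 : b.re ≤ ‖(t : ℂ) + Complex.I * b‖ := by
    refine le_trans ?_ (Complex.abs_im_le_norm _)
    simp [abs_of_pos hb]
  rw [h, norm_mul, sq]
  exact mul_le_mul h1 h2 hb.le (norm_nonneg _)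

lemma sq_add_sq_ne_zero {b : ℂ} (hb : 0 < b.re) (t : ℝ) : (t : ℂ) ^ 2 + b ^ 2 ≠ 0 := by
  rw [← norm_pos_iff]
  exact lt_of_lt_of_le (by positivity) (sq_re_le_norm_sq_add_sq hb t)

lemma ne_zero_of_re_pos {b : ℂ} (hb : 0 < b.re) : b ≠ 0 := by
  rintro rfl
  simp at hb

lemma norm_inv_sq_add_sq_le {b : ℂ} (hb : 0 < b.re) (t : ℝ) :
    ‖((t : ℂ) ^ 2 + b ^ 2)⁻¹‖ ≤ (b.re ^ 2)⁻¹ := by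
  rw [norm_inv]
  exact inv_anti₀ (by positivity) (sq_re_le_norm_sq_add_sq hb t)

lemma continuous_inv_sq_add_sq {b : ℂ} (hb : 0 < b.re) :
    Continuous fun t : ℝ => ((t : ℂ) ^ 2 + b ^ 2)⁻¹ :=
  Continuous.inv₀ (by fun_prop) (sq_add_sq_ne_zero hb)

lemma integrable_inv_sq_add_sq {b : ℂ} (hb : 0 < b.re) :
    Integrable fun t : ℝ => ((t : ℂ) ^ 2 + b ^ 2)⁻¹ := by
  refine (integrable_inv_one_add_sq.const_mul (1 + ‖1 - b ^ 2‖ * (b.re ^ 2)⁻¹)).mono'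
    (continuous_inv_sq_add_sq hb).aestronglyMeasurable (ae_of_all _ fun t => ?_)
  have hT : (0 : ℝ) < 1 + t ^ 2 := by positivity
  rw [← div_eq_mul_inv, le_div_iff₀ hT]
  have hn : ‖(1 : ℂ) + (t : ℂ) ^ 2‖ = 1 + t ^ 2 := by
    have h : (1 : ℂ) + (t : ℂ) ^ 2 = ((1 + t ^ 2 : ℝ) : ℂ) := by push_cast; rfl
    rw [h, Complex.norm_real, Real.norm_of_nonneg hT.le]
  rw [← hn, ← norm_mul]
  have h : ((t : ℂ) ^ 2 + b ^ 2)⁻¹ * (1 + (t : ℂ) ^ 2)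
      = 1 + (1 - b ^ 2) * ((t : ℂ) ^ 2 + b ^ 2)⁻¹ := by
    have := sq_add_sq_ne_zero hb t
    field_simp
    ring
  rw [h]
  refine (norm_add_le _ _).trans ?_
  rw [norm_one, norm_mul]
  gcongr
  exact norm_inv_sq_add_sq_le hb t

lemma integrable_inv_sq_add_sq_mul {b c : ℂ} (hb : 0 < b.re) (hc : 0 < c.re) :
    Integrable fun t : ℝ => ((t : ℂ) ^ 2 + b ^ 2)⁻¹ * ((t : ℂ) ^ 2 + c ^ 2)⁻¹ :=
  (integrable_inv_sq_add_sq hc).bdd_mul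
    (continuous_inv_sq_add_sq hb).aestronglyMeasurable
    (ae_of_all _ (norm_inv_sq_add_sq_le hb))

lemma log_I_mul_sub_log_neg {b : ℂ} (hb : 0 < b.re) :
    Complex.log (-(Complex.I * b)) - Complex.log (Complex.I * b) = -(π * Complex.I) := by
  have hb0 := ne_zero_of_re_pos hb
  have harg := abs_lt.1 (Complex.abs_arg_lt_pi_div_two_iff.2 (Or.inl hb))
  have hpi := Real.pi_pos
  have h1 : Complex.log (Complex.I * b) = Complex.log Complex.I + Complex.log b := by
    apply Complex.log_mul Complex.I_ne_zero hb0
    rw [Complex.arg_I]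
    constructor <;> linarith
  have h2 : Complex.log (-Complex.I * b) = Complex.log (-Complex.I) + Complex.log b := by
    apply Complex.log_mul (neg_ne_zero.2 Complex.I_ne_zero) hb0
    rw [Complex.arg_neg_I]
    constructor <;> linarith
  rw [← neg_mul, h1, h2, Complex.log_I, Complex.log_neg_I]
  ring

open Filter Topology in
lemma tendsto_log_sub_log_atTop (a : ℂ) :
    Tendsto (fun t : ℝ => Complex.log (t - a) - Complex.log (t + a)) atTop (𝓝 0) := by
  have hd : Tendsto (fun t : ℝ => a * ((t⁻¹ : ℝ) : ℂ)) atTop (𝓝 0) := by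
    have h : Tendsto (fun t : ℝ => ((t⁻¹ : ℝ) : ℂ)) atTop (𝓝 ((0 : ℝ) : ℂ)) :=
      (Complex.continuous_ofReal.tendsto 0).comp tendsto_inv_atTop_zero
    simpa using h.const_mul a
  have h1 : Tendsto (fun t : ℝ => 1 - a * ((t⁻¹ : ℝ) : ℂ)) atTop (𝓝 1) := by
    simpa using hd.const_sub 1
  have h2 : Tendsto (fun t : ℝ => 1 + a * ((t⁻¹ : ℝ) : ℂ)) atTop (𝓝 1) := by
    simpa using hd.const_add 1
  have h3 := (h1.clog Complex.one_mem_slitPlane).sub (h2.clog Complex.one_mem_slitPlane)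
  rw [sub_self] at h3
  refine h3.congr' ?_
  filter_upwards [eventually_gt_atTop 0, h1.eventually_ne one_ne_zero,
    h2.eventually_ne one_ne_zero] with t ht hn1 hn2
  have ht' : (t : ℂ) ≠ 0 := by exact_mod_cast ht.ne'
  have e1 : (t : ℂ) - a = t * (1 - a * ((t⁻¹ : ℝ) : ℂ)) := by
    push_cast
    field_simp
  have e2 : (t : ℂ) + a = t * (1 + a * ((t⁻¹ : ℝ) : ℂ)) := by
    push_cast
    field_simp
  rw [e1, e2, Complex.log_ofReal_mul ht hn1, Complex.log_ofReal_mul ht hn2]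
  ring

lemma integral_Ioi_inv_sq_add_sq {b : ℂ} (hb : 0 < b.re) :
    ∫ t in Ioi (0 : ℝ), ((t : ℂ) ^ 2 + b ^ 2)⁻¹ = π / (2 * b) := by
  have hb0 := ne_zero_of_re_pos hb
  have key := integral_Ioi_of_hasDerivAt_of_tendsto' (a := (0 : ℝ))
    (f := fun t : ℝ => (2 * Complex.I * b)⁻¹ *
      (Complex.log (t - Complex.I * b) - Complex.log (t + Complex.I * b)))
    (f' := fun t : ℝ => ((t : ℂ) ^ 2 + b ^ 2)⁻¹) (fun t _ => ?_)
    (integrable_inv_sq_add_sq hb).integrableOn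
    ((tendsto_log_sub_log_atTop (Complex.I * b)).const_mul _)
  · rw [key]
    simp only [Complex.ofReal_zero, zero_sub, zero_add]
    rw [log_I_mul_sub_log_neg hb]
    field_simp
    ring
  · have hm1 : (t : ℂ) - Complex.I * b ∈ Complex.slitPlane := by
      refine Or.inr ?_
      simp [hb.ne']
    have hm2 : (t : ℂ) + Complex.I * b ∈ Complex.slitPlane := by
      refine Or.inr ?_
      simp [hb.ne']
    have d0 : HasDerivAt (fun t : ℝ => (t : ℂ)) 1 t := Complex.ofRealCLM.hasDerivAt
    have d := (((d0.sub_const (Complex.I * b)).clog_real hm1).sub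
      ((d0.add_const (Complex.I * b)).clog_real hm2)).const_mul (2 * Complex.I * b)⁻¹
    refine d.congr_deriv ?_
    have n1 := Complex.slitPlane_ne_zero hm1
    have n2 := Complex.slitPlane_ne_zero hm2
    have h : (t : ℂ) ^ 2 + b ^ 2 = (t - Complex.I * b) * (t + Complex.I * b) := by
      linear_combination b ^ 2 * Complex.I_sq
    rw [h]
    field_simp
    ring

open Filter Topology in
lemma tendsto_mul_inv_sq_add_sq_atTop (b : ℂ) :
    Tendsto (fun t : ℝ => (t : ℂ) * ((t : ℂ) ^ 2 + b ^ 2)⁻¹) atTop (𝓝 0) := by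
  have h : Tendsto (fun t : ℝ => ((t⁻¹ : ℝ) : ℂ)) atTop (𝓝 ((0 : ℝ) : ℂ)) :=
    (Complex.continuous_ofReal.tendsto 0).comp tendsto_inv_atTop_zero
  have h2 : Tendsto (fun t : ℝ => ((t⁻¹ : ℝ) : ℂ) * (1 + b ^ 2 * ((t⁻¹ : ℝ) : ℂ) ^ 2)⁻¹)
      atTop (𝓝 (((0 : ℝ) : ℂ) * (1 + b ^ 2 * ((0 : ℝ) : ℂ) ^ 2)⁻¹)) :=
    h.mul ((((h.pow 2).const_mul (b ^ 2)).const_add 1).inv₀ (by simp))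
  rw [Complex.ofReal_zero, zero_mul] at h2
  refine h2.congr' ?_
  filter_upwards [eventually_gt_atTop 0] with t ht
  have ht' : (t : ℂ) ≠ 0 := by exact_mod_cast ht.ne'
  have e : (t : ℂ) ^ 2 + b ^ 2 = t ^ 2 * (1 + b ^ 2 * ((t⁻¹ : ℝ) : ℂ) ^ 2) := by
    push_cast
    field_simp
  rw [e, mul_inv]
  push_cast
  field_simp

lemma integral_Ioi_inv_sq_add_sq_mul_self {b : ℂ} (hb : 0 < b.re) :
    ∫ t in Ioi (0 : ℝ), ((t : ℂ) ^ 2 + b ^ 2)⁻¹ * ((t : ℂ) ^ 2 + b ^ 2)⁻¹ =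
      π / (4 * b ^ 3) := by
  have hb0 := ne_zero_of_re_pos hb
  have i1 := (integrable_inv_sq_add_sq hb).integrableOn (s := Ioi 0)
  have i2 := (integrable_inv_sq_add_sq_mul hb hb).integrableOn (s := Ioi 0)
  have key := integral_Ioi_of_hasDerivAt_of_tendsto' (a := (0 : ℝ))
    (f := fun t : ℝ => (t : ℂ) * ((t : ℂ) ^ 2 + b ^ 2)⁻¹)
    (f' := fun t : ℝ => 2 * b ^ 2 * (((t : ℂ) ^ 2 + b ^ 2)⁻¹ * ((t : ℂ) ^ 2 + b ^ 2)⁻¹) -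
      ((t : ℂ) ^ 2 + b ^ 2)⁻¹) (fun t _ => ?_)
    (Integrable.sub (i2.const_mul (2 * b ^ 2)) i1) (tendsto_mul_inv_sq_add_sq_atTop b)
  · rw [integral_sub (i2.const_mul _) i1, integral_const_mul, integral_Ioi_inv_sq_add_sq hb] at key
    simp only [Complex.ofReal_zero, zero_mul, sub_zero] at key
    have h : ∀ J : ℂ, 2 * b ^ 2 * J - π / (2 * b) = 0 → J = π / (4 * b ^ 3) := by
      intro J hJ
      field_simp at hJ ⊢
      linear_combination hJ
    exact h _ key
  · have n := sq_add_sq_ne_zero hb t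
    have d0 : HasDerivAt (fun t : ℝ => (t : ℂ)) 1 t := Complex.ofRealCLM.hasDerivAt
    have d := d0.mul (((d0.pow 2).add_const (b ^ 2)).inv n)
    refine d.congr_deriv ?_
    simp only [Pi.pow_apply, Pi.inv_apply, Nat.cast_ofNat]
    field_simp
    ring

lemma integral_Ioi_inv_sq_add_sq_mul {b c : ℂ} (hb : 0 < b.re) (hc : 0 < c.re) :
    ∫ t in Ioi (0 : ℝ), ((t : ℂ) ^ 2 + b ^ 2)⁻¹ * ((t : ℂ) ^ 2 + c ^ 2)⁻¹ =
      π / (2 * b * c * (b + c)) := by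
  have hb0 := ne_zero_of_re_pos hb
  have hc0 := ne_zero_of_re_pos hc
  have hbc : b + c ≠ 0 := ne_zero_of_re_pos (by simp; linarith)
  by_cases h : b = c
  · subst h
    rw [integral_Ioi_inv_sq_add_sq_mul_self hb]
    congr 1
    ring
  have hd : c - b ≠ 0 := sub_ne_zero.2 (Ne.symm h)
  have e : ∀ t : ℝ, ((t : ℂ) ^ 2 + b ^ 2)⁻¹ * ((t : ℂ) ^ 2 + c ^ 2)⁻¹ =
      ((c - b) * (b + c))⁻¹ * (((t : ℂ) ^ 2 + b ^ 2)⁻¹ - ((t : ℂ) ^ 2 + c ^ 2)⁻¹) := by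
    intro t
    have n1 := sq_add_sq_ne_zero hb t
    have n2 := sq_add_sq_ne_zero hc t
    field_simp
    ring
  simp_rw [e]
  rw [integral_const_mul, integral_sub (integrable_inv_sq_add_sq hb).integrableOn
    (integrable_inv_sq_add_sq hc).integrableOn, integral_Ioi_inv_sq_add_sq hb,
    integral_Ioi_inv_sq_add_sq hc]
  field_simp

/-- The sixth root of unity used here satisfies `c² = c - 1`, and its conjugate is `1 - c`. -/
lemma exists_sq_eq_sub_one : ∃ c : ℂ, c ^ 2 = c - 1 ∧ c.re = 1 / 2 := by
  refine ⟨1 / 2 + (√3 / 2 : ℝ) * Complex.I, ?_, by simp⟩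
  have h : ((√3 : ℝ) : ℂ) ^ 2 = 3 := by
    rw [← Complex.ofReal_pow, Real.sq_sqrt (by norm_num)]
    norm_num
  push_cast
  linear_combination (1 / 4) * Complex.I ^ 2 * h + (3 / 4) * Complex.I_sq

lemma integral_pow_six_div {w : ℂ} (hw : 0 < w.re) :
    ∫ t in Ioi (0 : ℝ), ((t : ℂ) ^ 2 + w ^ 2)⁻¹ * ((t : ℂ) ^ 6 / (1 + (t : ℂ) ^ 6)) =
      π / 6 * (1 / (w + 1) + (2 * w + 1) / (w ^ 2 + w + 1)) := by
  obtain ⟨c, hc, hcr⟩ := exists_sq_eq_sub_one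
  have h1r : 0 < (1 : ℂ).re := by simp
  have hc_re : 0 < c.re := by rw [hcr]; norm_num
  have hd_re : 0 < (1 - c).re := by simp [hcr]; norm_num
  have i0 := (integrable_inv_sq_add_sq hw).integrableOn (s := Ioi 0)
  have i1 := (integrable_inv_sq_add_sq_mul hw h1r).integrableOn (s := Ioi 0)
  have i2 := ((integrable_inv_sq_add_sq_mul hw hc_re).const_mul (c ^ 2)).integrableOn (s := Ioi 0)
  have i3 := ((integrable_inv_sq_add_sq_mul hw hd_re).const_mul
    ((1 - c) ^ 2)).integrableOn (s := Ioi 0)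
  have e : ∀ t : ℝ, ((t : ℂ) ^ 2 + w ^ 2)⁻¹ * ((t : ℂ) ^ 6 / (1 + (t : ℂ) ^ 6)) =
      ((t : ℂ) ^ 2 + w ^ 2)⁻¹ - 3⁻¹ * (((t : ℂ) ^ 2 + w ^ 2)⁻¹ * ((t : ℂ) ^ 2 + 1 ^ 2)⁻¹ +
        c ^ 2 * (((t : ℂ) ^ 2 + w ^ 2)⁻¹ * ((t : ℂ) ^ 2 + c ^ 2)⁻¹) +
        (1 - c) ^ 2 * (((t : ℂ) ^ 2 + w ^ 2)⁻¹ * ((t : ℂ) ^ 2 + (1 - c) ^ 2)⁻¹)) := by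
    intro t
    have n1 := sq_add_sq_ne_zero h1r t
    have n2 := sq_add_sq_ne_zero hc_re t
    have n3 := sq_add_sq_ne_zero hd_re t
    have hd : (1 - c) ^ 2 = -c := by linear_combination hc
    rw [hd] at n3 ⊢
    rw [hc] at n2 ⊢
    have f : 1 + (t : ℂ) ^ 6 =
        ((t : ℂ) ^ 2 + 1 ^ 2) * (((t : ℂ) ^ 2 + (c - 1)) * ((t : ℂ) ^ 2 + -c)) := by
      linear_combination ((t : ℂ) ^ 2 + 1) * hc
    have hsum : (t : ℂ) ^ 6 / (1 + (t : ℂ) ^ 6) = 1 - 3⁻¹ * (((t : ℂ) ^ 2 + 1 ^ 2)⁻¹ +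
        (c - 1) * ((t : ℂ) ^ 2 + (c - 1))⁻¹ + -c * ((t : ℂ) ^ 2 + -c)⁻¹) := by
      rw [f]
      generalize (t : ℂ) = x at *
      rw [one_pow] at n1 ⊢
      field_simp
      linear_combination x ^ 2 * hc
    rw [hsum]
    ring
  simp_rw [e]
  rw [integral_sub i0 (((i1.fun_add i2).fun_add i3).const_mul _), integral_const_mul,
    integral_add (i1.fun_add i2) i3, integral_add i1 i2, integral_const_mul, integral_const_mul,
    integral_Ioi_inv_sq_add_sq hw, integral_Ioi_inv_sq_add_sq_mul hw h1r,
    integral_Ioi_inv_sq_add_sq_mul hw hc_re, integral_Ioi_inv_sq_add_sq_mul hw hd_re]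
  have hw0 := ne_zero_of_re_pos hw
  have hc0 := ne_zero_of_re_pos hc_re
  have hd0 := ne_zero_of_re_pos hd_re
  have m1 : w + 1 ≠ 0 := ne_zero_of_re_pos (by simp; linarith)
  have m2 : w + c ≠ 0 := ne_zero_of_re_pos (by simp; linarith)
  have m3 : w + (1 - c) ≠ 0 := ne_zero_of_re_pos (by simp at hd_re ⊢; linarith)
  have f : w ^ 2 + w + 1 = (w + c) * (w + (1 - c)) := by linear_combination hc
  rw [f]
  field_simp
  ring

lemma sqrtNeg_sq {z : ℂ} (hz : z ≠ 0) : sqrtNeg z ^ 2 = -z := by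
  rw [sqrtNeg, ← Complex.exp_nat_mul]
  rw [show ((2 : ℕ) : ℂ) * (Complex.log (-z) / 2) = Complex.log (-z) by push_cast; ring]
  exact Complex.exp_log (neg_ne_zero.2 hz)

lemma sqrtNeg_re_pos {z : ℂ} (hz : -z ∈ Complex.slitPlane) : 0 < (sqrtNeg z).re := by
  rw [sqrtNeg, Complex.exp_re]
  refine mul_pos (Real.exp_pos _) (Real.cos_pos_of_mem_Ioo ?_)
  have h1 := Complex.neg_pi_lt_arg (-z)
  have h2 := lt_of_le_of_ne (Complex.arg_le_pi (-z)) (Complex.mem_slitPlane_iff_arg.1 hz).1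
  have : (Complex.log (-z) / 2).im = Complex.arg (-z) / 2 := by
    rw [show Complex.log (-z) / 2 = Complex.log (-z) / ((2 : ℝ) : ℂ) by norm_num,
      Complex.div_ofReal_im, Complex.log_im]
  rw [this]
  constructor <;> linarith

lemma neg_mem_slitPlane_of_ne {z : ℂ} (hz : ∀ s : ℝ, 0 ≤ s → z ≠ (s : ℂ)) :
    -z ∈ Complex.slitPlane := by
  by_contra h
  rw [Complex.mem_slitPlane_iff, not_or, not_lt, not_not] at h
  refine hz z.re (by simpa using h.1) (Complex.ext rfl ?_)
  simpa using h.2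

lemma integral_stieltjes_eq (z w : ℂ) (hwz : w ^ 2 = -z) :
    ∫ s in Ioi (0 : ℝ),
        (1 / ((s : ℂ) - z)) * ((s ^ ((5 : ℝ) / 2) / (π * (1 + s ^ 3)) : ℝ) : ℂ) =
      2 / π * ∫ t in Ioi (0 : ℝ),
        ((t : ℂ) ^ 2 + w ^ 2)⁻¹ * ((t : ℂ) ^ 6 / (1 + (t : ℂ) ^ 6)) := by
  rw [← integral_comp_rpow_Ioi_of_pos (p := 2) (by norm_num), ← integral_const_mul]
  refine setIntegral_congr_fun measurableSet_Ioi fun t (ht : 0 < t) => ?_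
  have h5 : (t ^ (2 : ℝ)) ^ ((5 : ℝ) / 2) = t ^ 5 := by
    rw [← Real.rpow_mul ht.le, ← Real.rpow_natCast]
    norm_num
  simp only [h5]
  rw [show (2 : ℝ) - 1 = 1 by norm_num, Real.rpow_one, Real.rpow_two, Complex.real_smul, hwz]
  push_cast
  rw [div_eq_mul_inv _ ((π : ℂ) * _), mul_inv]
  ring

/-- For `λ ∈ ℂ∖(ℝ₊ ∪ {-1})`:
`λ/(1+λ√(-λ)) = -2/(3(1+λ)) + ∫₀^∞ (s-λ)⁻¹·s^{5/2}/(π(1+s³)) ds`. -/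
theorem stmt_15 (z : ℂ) (hz : ∀ s : ℝ, 0 ≤ s → z ≠ (s : ℂ)) (hz1 : z ≠ -1) :
    z / (1 + z * sqrtNeg z) =
      -2 / (3 * (1 + z)) +
        ∫ s in Ioi (0 : ℝ),
          (1 / ((s : ℂ) - z)) * ((s ^ ((5 : ℝ) / 2) / (π * (1 + s ^ 3)) : ℝ) : ℂ) := by
  have hz0 : z ≠ 0 := by simpa using hz 0 le_rfl
  have hsq := sqrtNeg_sq hz0
  have hre := sqrtNeg_re_pos (neg_mem_slitPlane_of_ne hz)
  rw [integral_stieltjes_eq z (sqrtNeg z) hsq, integral_pow_six_div hre]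
  generalize sqrtNeg z = w at hsq hre ⊢
  obtain rfl : z = -w ^ 2 := by rw [hsq, neg_neg]
  have hpi : (π : ℂ) ≠ 0 := by exact_mod_cast Real.pi_ne_zero
  have m1 : w + 1 ≠ 0 := ne_zero_of_re_pos (by simp; linarith)
  have m2 : w - 1 ≠ 0 := by
    intro h
    rw [sub_eq_zero] at h
    simp [h] at hz1
  have m3 : w ^ 2 + w + 1 ≠ 0 := by
    obtain ⟨c, hc, hcr⟩ := exists_sq_eq_sub_one
    have k1 : w + c ≠ 0 := ne_zero_of_re_pos (by simp [hcr]; linarith)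
    have k2 : w + (1 - c) ≠ 0 := ne_zero_of_re_pos (by simp [hcr]; linarith)
    rw [show w ^ 2 + w + 1 = (w + c) * (w + (1 - c)) by linear_combination hc]
    exact mul_ne_zero k1 k2
  have f1 : 1 + -w ^ 2 * w = -((w - 1) * (w ^ 2 + w + 1)) := by ring
  have f2 : 1 + -w ^ 2 = -((w - 1) * (w + 1)) := by ring
  rw [f1, f2]
  obtain ⟨q, hq⟩ : ∃ q, q = w ^ 2 + w + 1 := ⟨_, rfl⟩
  rw [← hq] at m3 ⊢
  field_simp
  rw [hq]
  ring
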